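/- Let S₁ and S₂ be stabiliser groups on N qubits and let ρ_i = 2^{−N} Σ_{g∈S_i} g be the corresponding stabiliser states. Then the overlap Tr(ρ₁ ρ₂) is either 0 or equal to 2^{−j} for some integer j with 0 ≤ j ≤ N. -/

import Mathlib

open Matrix
open scoped Kronecker

/-- The Pauli matrix `X`. -/
noncomputable def PauliX : Matrix (Fin 2) (Fin 2) ℂ := !![0, 1; 1, 0]

/-- The Pauli matrix `Y`. -/
noncomputable def PauliY : Matrix (Fin 2) (Fin 2) ℂ := !![0, -Complex.I; Complex.I, 0]

/-- The Pauli matrix `Z`. -/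
noncomputable def PauliZ : Matrix (Fin 2) (Fin 2) ℂ := !![1, 0; 0, -1]

/-- The Pauli string `σ 1 ⊗ ⋯ ⊗ σ N`, realised as a matrix indexed by
`Fin N → Fin 2` (the `N`-fold tensor product of `ℂ²`). -/
noncomputable def PString {N : ℕ} (σ : Fin N → Matrix (Fin 2) (Fin 2) ℂ) :
    Matrix (Fin N → Fin 2) (Fin N → Fin 2) ℂ :=
  Matrix.of fun a b => ∏ i, σ i (a i) (b i)

/-- `S` is a stabiliser group on `N` qubits: a finite abelian group of signed Pauli
strings, not containing `-1`. -/
def IsStabiliserGroup {N : ℕ}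
    (S : Finset (Matrix (Fin N → Fin 2) (Fin N → Fin 2) ℂ)) : Prop :=
  (1 : Matrix (Fin N → Fin 2) (Fin N → Fin 2) ℂ) ∈ S ∧
  (∀ g ∈ S, ∀ h ∈ S, g * h ∈ S) ∧
  (∀ g ∈ S, ∀ h ∈ S, g * h = h * g) ∧
  (∀ g ∈ S, ∃ (s : ℂ) (σ : Fin N → Matrix (Fin 2) (Fin 2) ℂ),
    (s = 1 ∨ s = -1) ∧
    (∀ i, σ i ∈ ({1, PauliX, PauliY, PauliZ} : Set (Matrix (Fin 2) (Fin 2) ℂ))) ∧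
    g = s • PString σ) ∧
  (-1 : Matrix (Fin N → Fin 2) (Fin N → Fin 2) ℂ) ∉ S

/-- The predicate of being a signed Pauli string. -/
def IsSignedPauliString {N : ℕ} (g : Matrix (Fin N → Fin 2) (Fin N → Fin 2) ℂ) : Prop :=
  ∃ (s : ℂ) (σ : Fin N → Matrix (Fin 2) (Fin 2) ℂ),
    (s = 1 ∨ s = -1) ∧
    (∀ i, σ i ∈ ({1, PauliX, PauliY, PauliZ} : Set (Matrix (Fin 2) (Fin 2) ℂ))) ∧
    g = s • PString σ

theorem pauli_mul_self {p : Matrix (Fin 2) (Fin 2) ℂ}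
    (hp : p ∈ ({1, PauliX, PauliY, PauliZ} : Set (Matrix (Fin 2) (Fin 2) ℂ))) : p * p = 1 := by
  simp only [Set.mem_insert_iff, Set.mem_singleton_iff] at hp
  rcases hp with rfl | rfl | rfl | rfl <;>
    simp [PauliX, PauliY, PauliZ, Matrix.one_fin_two]

theorem trace_pauli_mul_pauli {p q : Matrix (Fin 2) (Fin 2) ℂ}
    (hp : p ∈ ({1, PauliX, PauliY, PauliZ} : Set (Matrix (Fin 2) (Fin 2) ℂ)))
    (hq : q ∈ ({1, PauliX, PauliY, PauliZ} : Set (Matrix (Fin 2) (Fin 2) ℂ)))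
    (hpq : p ≠ q) : (p * q).trace = 0 := by
  simp only [Set.mem_insert_iff, Set.mem_singleton_iff] at hp hq
  rcases hp with rfl | rfl | rfl | rfl <;> rcases hq with rfl | rfl | rfl | rfl <;>
    first
    | exact absurd rfl hpq
    | simp [PauliX, PauliY, PauliZ, Matrix.trace_fin_two]

theorem PString_mul {N : ℕ} (σ τ : Fin N → Matrix (Fin 2) (Fin 2) ℂ) :
    PString σ * PString τ = PString fun i => σ i * τ i := by
  ext a b
  simp only [PString, Matrix.mul_apply, Matrix.of_apply, Finset.prod_univ_sum,
    Fintype.piFinset_univ, Finset.prod_mul_distrib]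

theorem trace_PString {N : ℕ} (σ : Fin N → Matrix (Fin 2) (Fin 2) ℂ) :
    (PString σ).trace = ∏ i, (σ i).trace := by
  simp only [PString, Matrix.trace, Matrix.diag, Matrix.of_apply, Finset.prod_univ_sum,
    Fintype.piFinset_univ]

theorem PString_one {N : ℕ} :
    PString (fun _ : Fin N => (1 : Matrix (Fin 2) (Fin 2) ℂ)) = 1 := by
  ext a b
  simp [PString, Matrix.one_apply, Finset.prod_ite_zero, funext_iff]

theorem trace_one_qubits (N : ℕ) :
    (1 : Matrix (Fin N → Fin 2) (Fin N → Fin 2) ℂ).trace = 2 ^ N := by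
  simp [Matrix.trace_one]

namespace IsSignedPauliString

variable {N : ℕ} {g h : Matrix (Fin N → Fin 2) (Fin N → Fin 2) ℂ}

theorem mul_self (hg : IsSignedPauliString g) : g * g = 1 := by
  obtain ⟨s, σ, hs, hσ, rfl⟩ := hg
  have hσσ : (fun i => σ i * σ i) = fun _ => 1 := funext fun i => pauli_mul_self (hσ i)
  have hss : s * s = 1 := by rcases hs with rfl | rfl <;> norm_num
  rw [smul_mul_smul_comm, hss, PString_mul, hσσ, PString_one, one_smul]

theorem eq_or_eq_neg_or_trace_mul_eq_zero (hg : IsSignedPauliString g)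
    (hh : IsSignedPauliString h) : g = h ∨ g = -h ∨ (g * h).trace = 0 := by
  obtain ⟨s, σ, hs, hσ, rfl⟩ := hg
  obtain ⟨t, τ, ht, hτ, rfl⟩ := hh
  by_cases hστ : σ = τ
  · subst hστ
    rcases hs with rfl | rfl <;> rcases ht with rfl | rfl <;> simp
  · obtain ⟨i, hi⟩ := Function.ne_iff.mp hστ
    right; right
    rw [smul_mul_smul_comm, Matrix.trace_smul, PString_mul, trace_PString,
      Finset.prod_eq_zero (Finset.mem_univ i) (trace_pauli_mul_pauli (hσ i) (hτ i) hi), smul_zero]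

theorem ne_neg_self (hg : IsSignedPauliString g) : g ≠ -g := by
  intro h
  have h2 : (1 : Matrix (Fin N → Fin 2) (Fin N → Fin 2) ℂ) = -1 := by
    have := congrArg (g * ·) h
    simpa [hg.mul_self] using this
  have h3 := congrArg Matrix.trace h2
  rw [Matrix.trace_neg, trace_one_qubits, self_eq_neg] at h3
  exact pow_ne_zero N two_ne_zero h3

open scoped Classical in
theorem trace_mul (hg : IsSignedPauliString g) (hh : IsSignedPauliString h) :
    (g * h).trace = (if g = h then 2 ^ N else 0) - if -g = h then 2 ^ N else 0 := by
  rcases hg.eq_or_eq_neg_or_trace_mul_eq_zero hh with rfl | rfl | h0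
  · rw [if_pos rfl, if_neg hg.ne_neg_self.symm, hg.mul_self, trace_one_qubits, sub_zero]
  · rw [if_neg hh.ne_neg_self.symm, if_pos (neg_neg h), neg_mul, hh.mul_self, Matrix.trace_neg,
      trace_one_qubits, zero_sub]
  · have hN : (2 : ℂ) ^ N ≠ 0 := pow_ne_zero N two_ne_zero
    rw [if_neg, if_neg, h0, sub_zero]
    · rintro rfl
      rw [mul_neg, hg.mul_self, Matrix.trace_neg, trace_one_qubits] at h0
      exact hN (neg_eq_zero.mp h0)
    · rintro rfl
      rw [hg.mul_self, trace_one_qubits] at h0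
      exact hN h0

end IsSignedPauliString

/-- The trace of an idempotent matrix is a natural number. -/
theorem exists_trace_eq_natCast_of_isIdempotentElem {n K : Type*} [Fintype n] [DecidableEq n]
    [Field K] {P : Matrix n n K} (hP : IsIdempotentElem P) : ∃ r : ℕ, P.trace = r := by
  have hlin : IsIdempotentElem (Matrix.toLin' P) := by
    rw [IsIdempotentElem, Module.End.mul_eq_comp, ← Matrix.toLin'_mul, hP.eq]
  exact ⟨_, (Matrix.trace_toLin'_eq P).symm.trans
    (LinearMap.IsProj.trace (LinearMap.isProj_range_iff_isIdempotentElem _ |>.mpr hlin))⟩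

namespace IsStabiliserGroup

variable {N : ℕ} {S S₁ S₂ : Finset (Matrix (Fin N → Fin 2) (Fin N → Fin 2) ℂ)}

theorem isSignedPauliString (hS : IsStabiliserGroup S)
    {g : Matrix (Fin N → Fin 2) (Fin N → Fin 2) ℂ} (hg : g ∈ S) : IsSignedPauliString g :=
  hS.2.2.2.1 g hg

open scoped Classical in
theorem inter (hS₁ : IsStabiliserGroup S₁) (hS₂ : IsStabiliserGroup S₂) :
    IsStabiliserGroup (S₁ ∩ S₂) := by
  obtain ⟨one₁, mul₁, comm₁, pauli₁, neg₁⟩ := hS₁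
  obtain ⟨one₂, mul₂, -⟩ := hS₂
  simp only [IsStabiliserGroup, Finset.mem_inter]
  exact ⟨⟨one₁, one₂⟩, fun g hg h hh => ⟨mul₁ g hg.1 h hh.1, mul₂ g hg.2 h hh.2⟩,
    fun g hg h hh => comm₁ g hg.1 h hh.1, fun g hg => pauli₁ g hg.1, fun h => neg₁ h.1⟩

theorem mul_sum (hS : IsStabiliserGroup S) {g : Matrix (Fin N → Fin 2) (Fin N → Fin 2) ℂ}
    (hg : g ∈ S) : g * ∑ h ∈ S, h = ∑ h ∈ S, h := by
  have hgg := (hS.isSignedPauliString hg).mul_self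
  rw [Finset.mul_sum]
  refine Finset.sum_nbij' (g * ·) (g * ·) (fun h hh => hS.2.1 g hg h hh)
    (fun h hh => hS.2.1 g hg h hh) ?_ ?_ fun _ _ => rfl
  all_goals
    intro h _
    simp only [← mul_assoc, hgg, one_mul]

theorem trace_sum (hS : IsStabiliserGroup S) : (∑ g ∈ S, g).trace = 2 ^ N := by
  rw [Matrix.trace_sum, Finset.sum_eq_single_of_mem 1 hS.1, trace_one_qubits]
  intro g hg hg1
  rcases (hS.isSignedPauliString hg).eq_or_eq_neg_or_trace_mul_eq_zero
    (hS.isSignedPauliString hS.1) with h | h | h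
  · exact absurd h hg1
  · exact absurd (h ▸ hg) hS.2.2.2.2
  · rwa [mul_one] at h

theorem card_dvd_two_pow (hS : IsStabiliserGroup S) : S.card ∣ 2 ^ N := by
  have hcard : (S.card : ℂ) ≠ 0 := Nat.cast_ne_zero.mpr (Finset.card_ne_zero_of_mem hS.1)
  have hP : IsIdempotentElem ((S.card : ℂ)⁻¹ • ∑ g ∈ S, g) := by
    have hsq : (∑ g ∈ S, g) * ∑ g ∈ S, g = (S.card : ℂ) • ∑ g ∈ S, g := by
      rw [Finset.sum_mul, Finset.sum_congr rfl fun g hg => hS.mul_sum hg, Finset.sum_const,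
        Nat.cast_smul_eq_nsmul]
    rw [IsIdempotentElem, smul_mul_smul_comm, hsq, smul_smul, inv_mul_cancel_right₀ hcard]
  obtain ⟨r, hr⟩ := exists_trace_eq_natCast_of_isIdempotentElem hP
  rw [Matrix.trace_smul, hS.trace_sum, smul_eq_mul, inv_mul_eq_iff_eq_mul₀ hcard] at hr
  exact ⟨r, by exact_mod_cast hr⟩

open scoped Classical in
theorem trace_sum_mul_sum (hS₁ : IsStabiliserGroup S₁) (hS₂ : IsStabiliserGroup S₂) :
    ((∑ g ∈ S₁, g) * ∑ h ∈ S₂, h).trace =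
      2 ^ N * (((S₁ ∩ S₂).card : ℂ) - ({g ∈ S₁ | -g ∈ S₂} : Finset _).card) := by
  have hrow : ∀ g ∈ S₁, (∑ h ∈ S₂, (g * h).trace) =
      (2 : ℂ) ^ N * ((if g ∈ S₂ then 1 else 0) - if -g ∈ S₂ then 1 else 0) := by
    intro g hg
    rw [Finset.sum_congr rfl fun h hh =>
      (hS₁.isSignedPauliString hg).trace_mul (hS₂.isSignedPauliString hh),
      Finset.sum_sub_distrib, Finset.sum_ite_eq, Finset.sum_ite_eq]
    split_ifs <;> simp
  simp_rw [Finset.sum_mul_sum, Matrix.trace_sum]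
  rw [Finset.sum_congr rfl hrow, ← Finset.mul_sum, Finset.sum_sub_distrib, Finset.sum_boole,
    Finset.sum_boole, Finset.filter_mem_eq_inter]

open scoped Classical in
theorem card_filter_neg_mem (hS₁ : IsStabiliserGroup S₁) (hS₂ : IsStabiliserGroup S₂)
    {b : Matrix (Fin N → Fin 2) (Fin N → Fin 2) ℂ} (hb₁ : b ∈ S₁) (hb₂ : -b ∈ S₂) :
    ({g ∈ S₁ | -g ∈ S₂} : Finset _).card = (S₁ ∩ S₂).card := by
  have hbb := (hS₁.isSignedPauliString hb₁).mul_self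
  have hinv : ∀ g, b * (b * g) = g := fun g => by rw [← mul_assoc, hbb, one_mul]
  refine Finset.card_nbij' (b * ·) (b * ·) ?_ ?_ (fun g _ => hinv g) (fun g _ => hinv g)
  all_goals
    intro g hg
    simp only [Finset.coe_filter, Set.mem_ofPred_eq, Finset.coe_inter, Set.mem_inter_iff,
      Finset.mem_coe] at hg ⊢
    exact ⟨hS₁.2.1 b hb₁ g hg.1, by simpa using hS₂.2.1 _ hb₂ _ hg.2⟩

end IsStabiliserGroup

/-- **Possible values of the overlap of two stabiliser states.** The overlap
`Tr(ρ₁ρ₂)` of two stabiliser states on `N` qubits is either `0` or `2^(-j)` for some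
integer `0 ≤ j ≤ N`. -/
theorem stmt15 (N : ℕ)
    (S₁ S₂ : Finset (Matrix (Fin N → Fin 2) (Fin N → Fin 2) ℂ))
    (hS₁ : IsStabiliserGroup S₁) (hS₂ : IsStabiliserGroup S₂)
    (ρ₁ ρ₂ : Matrix (Fin N → Fin 2) (Fin N → Fin 2) ℂ)
    (hρ₁ : ρ₁ = ((2 : ℂ) ^ N)⁻¹ • ∑ g ∈ S₁, g)
    (hρ₂ : ρ₂ = ((2 : ℂ) ^ N)⁻¹ • ∑ g ∈ S₂, g) :
    (ρ₁ * ρ₂).trace = 0 ∨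
    ∃ j : ℕ, j ≤ N ∧ (ρ₁ * ρ₂).trace = ((2 : ℂ) ^ j)⁻¹ := by
  classical
  have htrace : (ρ₁ * ρ₂).trace =
      ((2 : ℂ) ^ N)⁻¹ * (((S₁ ∩ S₂).card : ℂ) - ({g ∈ S₁ | -g ∈ S₂} : Finset _).card) := by
    rw [hρ₁, hρ₂, smul_mul_smul_comm, Matrix.trace_smul, hS₁.trace_sum_mul_sum hS₂, smul_eq_mul]
    field_simp
  rcases ({g ∈ S₁ | -g ∈ S₂} : Finset _).eq_empty_or_nonempty with hB | ⟨b, hb⟩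
  · right
    obtain ⟨k, hk, hcard⟩ := (Nat.dvd_prime_pow Nat.prime_two).mp (hS₁.inter hS₂).card_dvd_two_pow
    refine ⟨N - k, Nat.sub_le N k, ?_⟩
    rw [htrace, hB, Finset.card_empty, hcard, pow_sub₀ _ two_ne_zero hk]
    simp [mul_comm]
  · left
    rw [Finset.mem_filter] at hb
    rw [htrace, hS₁.card_filter_neg_mem hS₂ hb.1 hb.2, sub_self, mul_zero]
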